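/- arXiv:2009.08530 — 2 statements merged into one kernel-verified Lean document; each statement's English description precedes it below -/
import Mathlib

section
/- Let R be a graded polynomial ring in n variables over a field and M a finitely generated graded R-module. If there exists an exact sequence 0 → M → F_1 → ⋯ → F_n with each F_k a finitely generated free graded R-module (i.e., M is an n-th syzygy), then M is free. -/
universe u

/-- `IsSyzygy R j M` says that `M` is a `j`-th syzygy over `R`: there is an exact
sequence `0 → M → F₁ → ⋯ → F_j` of finitely generated free `R`-modules `F₁, …, F_j`.
This is encoded inductively: every module is a `0`-th syzygy, and `M` is a
`(j+1)`-st syzygy iff it embeds in a finitely generated free module with cokernel a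
`j`-th syzygy (which is equivalent to the exact-sequence formulation). -/
def IsSyzygy (R : Type u) [CommRing R] :
    ∀ (_ : ℕ) (M : Type u) [AddCommGroup M] [Module R M], Prop
  | 0, _, _, _ => True
  | j + 1, M, _, _ => ∃ (m : ℕ) (f : M →ₗ[R] (Fin m → R)),
      Function.Injective f ∧ IsSyzygy R j ((Fin m → R) ⧸ LinearMap.range f)

section
open Matrix

/-- rows equivalent under GL -/
def RowEq {ι R : Type*} [Fintype ι] [DecidableEq ι] [CommRing R] (v w : ι → R) : Prop :=
  ∃ g : (Matrix ι ι R)ˣ, g.1 *ᵥ v = w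

namespace RowEq
variable {ι R S : Type*} [Fintype ι] [DecidableEq ι] [CommRing R] [CommRing S]

theorem refl (v : ι → R) : RowEq v v := ⟨1, by simp⟩

theorem symm {v w : ι → R} (h : RowEq v w) : RowEq w v := by
  obtain ⟨g, rfl⟩ := h
  exact ⟨g⁻¹, by simp [Matrix.mulVec_mulVec]⟩

theorem trans {u v w : ι → R} (h : RowEq u v) (h' : RowEq v w) : RowEq u w := by
  obtain ⟨g, rfl⟩ := h
  obtain ⟨g', rfl⟩ := h'
  exact ⟨g' * g, by simp [Matrix.mulVec_mulVec]⟩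

theorem map (φ : R →+* S) {v w : ι → R} (h : RowEq v w) : RowEq (φ ∘ v) (φ ∘ w) := by
  obtain ⟨g, rfl⟩ := h
  refine ⟨Units.map (RingHom.mapMatrix φ).toMonoidHom g, ?_⟩
  ext i
  simpa using (RingHom.map_mulVec φ g.1 v i).symm

theorem of_map_equiv (φ : R ≃+* S) {v w : ι → R} (h : RowEq (φ ∘ v) (φ ∘ w)) : RowEq v w := by
  have := h.map (φ.symm : S →+* R)
  simpa [Function.comp_def] using this

theorem of_det {v w : ι → R} (M : Matrix ι ι R) (hd : IsUnit M.det) (h : M *ᵥ v = w) :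
    RowEq v w := by
  obtain ⟨u, hu⟩ := (Matrix.isUnit_iff_isUnit_det M).2 hd
  exact ⟨u, by rw [hu, h]⟩

theorem smul (u : Rˣ) (v : ι → R) : RowEq v (fun i => (u : R) * v i) :=
  of_det ((u : R) • (1 : Matrix ι ι R)) (by simpa using u.isUnit.pow _) (by
    ext i; simp [Matrix.smul_mulVec])

/-- add multiples of the `i`-th coordinate to the others -/
theorem add_col (v : ι → R) (i : ι) (c : ι → R) (hc : c i = 0) :
    RowEq v (fun j => v j + c j * v i) := by
  have key : ∀ c : ι → R, ∀ v : ι → R, (1 + Matrix.vecMulVec c (Pi.single i 1)) *ᵥ v =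
      fun j => v j + c j * v i := by
    intro c v
    ext j
    simp [Matrix.add_mulVec, Matrix.vecMulVec_mulVec, mul_comm]
  refine ⟨⟨1 + Matrix.vecMulVec c (Pi.single i 1), 1 - Matrix.vecMulVec c (Pi.single i 1), ?_, ?_⟩,
    key c v⟩ <;>
  simp [mul_add, mul_sub, add_mul, sub_mul, Matrix.vecMulVec_mul_vecMulVec, hc]

/-- add a combination of other coordinates to the `i`-th one -/
theorem add_dot (v : ι → R) (i : ι) (c : ι → R) (hc : c i = 0) :
    RowEq v (v + Pi.single i (c ⬝ᵥ v)) := by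
  refine ⟨⟨1 + Matrix.vecMulVec (Pi.single i 1) c, 1 - Matrix.vecMulVec (Pi.single i 1) c, ?_, ?_⟩,
    ?_⟩
  · simp [mul_add, mul_sub, add_mul, sub_mul, Matrix.vecMulVec_mul_vecMulVec, hc]
  · simp [mul_add, mul_sub, add_mul, sub_mul, Matrix.vecMulVec_mul_vecMulVec, hc]
  · ext j
    by_cases h : j = i
    · subst h; simp [Matrix.add_mulVec, Matrix.vecMulVec_mulVec]
    · simp [Matrix.add_mulVec, Matrix.vecMulVec_mulVec, h]

theorem reindex {κ : Type*} [Fintype κ] [DecidableEq κ] (e : κ ≃ ι) {v w : ι → R}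
    (h : RowEq (v ∘ e) (w ∘ e)) : RowEq v w := by
  obtain ⟨g, hg⟩ := h
  refine ⟨Units.map (Matrix.reindexAlgEquiv R R e).toMulEquiv.toMonoidHom g, ?_⟩
  ext i
  have := congrFun hg (e.symm i)
  simp at this
  rw [← this]
  simp [Matrix.submatrix_mulVec_equiv]

theorem single_perm (i j : ι) : RowEq (Pi.single i 1 : ι → R) (Pi.single j 1) := by
  classical
  refine of_det (Matrix.of fun a b => if a = Equiv.swap i j b then 1 else 0) ?_ ?_
  · have : (Matrix.of fun a b => if a = Equiv.swap i j b then (1:R) else 0) =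
      ((Equiv.swap i j).permMatrix R) := by
      ext a b
      have : (b = Equiv.swap i j a) ↔ (a = Equiv.swap i j b) := by
        rw [eq_comm, Equiv.swap_apply_eq_iff]
      simp [Equiv.Perm.permMatrix, PEquiv.toMatrix_apply, eq_comm, this]
    rw [this, Matrix.det_permutation]
    rcases Int.units_eq_one_or (Equiv.Perm.sign (Equiv.swap i j)) with h | h <;> simp [h]
  · ext a
    simp [Pi.single_apply]

/-- a row with a unit component is equivalent to the basis vector -/
theorem of_unit (v : ι → R) (i j : ι) (h : IsUnit (v i)) : RowEq v (Pi.single j 1) := by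
  obtain ⟨u, hu⟩ := h
  refine ((smul u⁻¹ v).trans ?_).trans (single_perm i j)
  refine (add_col _ i (fun j => if j = i then 0 else - (((u⁻¹ : Rˣ) : R) * v j)) (by simp)).trans ?_
  have : (fun j => ((u⁻¹ : Rˣ) : R) * v j + (if j = i then 0 else - (((u⁻¹ : Rˣ) : R) * v j)) *
      (((u⁻¹ : Rˣ) : R) * v i)) = Pi.single i 1 := by
    ext j
    by_cases h : j = i
    · subst h; simp [← hu]
    · simp [← hu, h]
  rw [this]
  exact refl _

end RowEq

/-- Suslin's lemma -/
theorem suslin_det {B : Type*} [CommRing B] [IsDomain B] (r f g p q F G P Q : B) (hr : r ≠ 0)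
    (h1 : p * f + q * g = r) (h2 : (p + r * P) * (f + r * F) + (q + r * Q) * (g + r * G) = r) :
    (!![1 + F * p + Q * g, F * q - Q * f; G * p - P * g, 1 + G * q + P * f] :
      Matrix (Fin 2) (Fin 2) B).det = 1 := by
  have h3 : P * f + p * F + Q * g + q * G + r * (P * F + Q * G) = 0 := by
    apply mul_left_cancel₀ hr
    linear_combination h2 - h1
  rw [Matrix.det_fin_two_of]
  linear_combination h3 + (P*F+Q*G) * h1

theorem suslin_step {B κ : Type*} [CommRing B] [IsDomain B] [Fintype κ] [DecidableEq κ]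
    (r p q P Q : B) (v V : Fin 2 ⊕ κ → B)
    (h1 : p * v (.inl 0) + q * v (.inl 1) = r)
    (h2 : (p + r * P) * (v (.inl 0) + r * V (.inl 0)) +
      (q + r * Q) * (v (.inl 1) + r * V (.inl 1)) = r) :
    RowEq v (fun i => v i + r * V i) := by
  by_cases hr : r = 0
  · subst hr; convert RowEq.refl v using 2; simp
  have hd := suslin_det r _ _ p q _ _ P Q hr h1 h2
  set N := (!![1 + V (.inl 0) * p + Q * v (.inl 1), V (.inl 0) * q - Q * v (.inl 0);
    V (.inl 1) * p - P * v (.inl 1), 1 + V (.inl 1) * q + P * v (.inl 0)] :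
      Matrix (Fin 2) (Fin 2) B) with hN
  refine RowEq.of_det (Matrix.fromBlocks N 0
    (Matrix.of fun i j => V (.inr i) * ![p, q] j) 1) ?_ ?_
  · simp [Matrix.det_fromBlocks_zero₁₂, hd]
  · rw [Matrix.fromBlocks_mulVec]
    ext i
    rcases i with i | i
    · fin_cases i
      · simp [hN, Matrix.mulVec, dotProduct, Fin.sum_univ_two]
        linear_combination V (.inl 0) * h1
      · simp [hN, Matrix.mulVec, dotProduct, Fin.sum_univ_two]
        linear_combination V (.inl 1) * h1
    · simp [Matrix.mulVec, dotProduct, Fin.sum_univ_two, Matrix.one_apply]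
      linear_combination V (.inr i) * h1
end

section
open Matrix

open Polynomial in
theorem pid_stable_range {D : Type*} [CommRing D] [IsDomain D] [IsPrincipalIdealRing D]
    (a b c : D) (ha : a ≠ 0) (s t u : D) (hstu : s * a + t * b + u * c = 1) :
    ∃ h, IsCoprime a (b + h * c) := by
  classical
  refine ⟨((UniqueFactorizationMonoid.factors a).filter (fun p => ¬ p ∣ b)).prod, ?_⟩
  apply isCoprime_of_prime_dvd (fun h => ha h.1)
  intro p hp hpa hpd
  by_cases hb : p ∣ b
  · rw [dvd_add_right hb] at hpd
    rcases hp.dvd_or_dvd hpd with h | h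
    · obtain ⟨q, hq, hpq⟩ := hp.exists_mem_multiset_dvd h
      rw [Multiset.mem_filter] at hq
      have hq' := UniqueFactorizationMonoid.prime_of_factor q hq.1
      exact hq.2 (((hp.associated_of_dvd hq' hpq).dvd_iff_dvd_left).1 hb)
    · apply hp.not_isUnit
      apply isUnit_of_dvd_one
      rw [← hstu]
      exact dvd_add (dvd_add (hpa.mul_left _) (hb.mul_left _)) (h.mul_left _)
  · apply hb
    obtain ⟨q, hq, hpq⟩ := UniqueFactorizationMonoid.exists_mem_factors_of_dvd ha hp.irreducible hpa
    have h1 : q ∣ ((UniqueFactorizationMonoid.factors a).filter (fun p => ¬ p ∣ b)).prod :=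
      Multiset.dvd_prod (Multiset.mem_filter.2 ⟨hq, fun h => hb ((hpq.dvd_iff_dvd_left).2 h)⟩)
    exact (dvd_add_left ((hpq.dvd.trans h1).mul_right c)).1 hpd

open Polynomial in
theorem exists_resultant {A : Type*} [CommRing A] (m : Ideal A) [m.IsMaximal] (f g : A[X])
    (hf : f.Monic)
    (h : IsCoprime (f.map (Ideal.Quotient.mk m)) (g.map (Ideal.Quotient.mk m))) :
    ∃ r ∉ m, ∃ p q : A[X], p * f + q * g = C r := by
  by_contra! hcon
  have hfin : Module.Finite A (AdjoinRoot f) := hf.finite_adjoinRoot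
  have hle : (Ideal.span {AdjoinRoot.mk f g}).comap (algebraMap A (AdjoinRoot f)) ≤ m := by
    intro r hr
    by_contra hrm
    rw [Ideal.mem_comap, Ideal.mem_span_singleton'] at hr
    obtain ⟨q, hq⟩ := hr
    obtain ⟨q, rfl⟩ := AdjoinRoot.mk_surjective q
    have : AdjoinRoot.mk f (C r) = AdjoinRoot.mk f (q * g) := by
      rw [map_mul, hq]; rfl
    rw [AdjoinRoot.mk_eq_mk] at this
    obtain ⟨p, hp⟩ := this
    exact hcon r hrm p q (by linear_combination -hp)
  obtain ⟨Q, hQ, hQp, hQm⟩ := Ideal.exists_ideal_over_prime_of_isIntegral m _ hle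
  obtain ⟨p, q, hpq⟩ := h
  have hsurj := Polynomial.map_surjective _ (Ideal.Quotient.mk_surjective (I := m))
  obtain ⟨p, rfl⟩ := hsurj p
  obtain ⟨q, rfl⟩ := hsurj q
  have h1 : p * f + q * g - 1 ∈ RingHom.ker (mapRingHom (Ideal.Quotient.mk m)) := by
    simp [RingHom.mem_ker, hpq]
  rw [Polynomial.ker_mapRingHom, Ideal.mk_ker] at h1
  have h2 : Ideal.map C m ≤ Q.comap (AdjoinRoot.mk f) := by
    rw [Ideal.map_le_iff_le_comap, Ideal.comap_comap, ← hQm]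
    exact le_rfl
  have h3 := h2 h1
  rw [Ideal.mem_comap] at h3
  apply hQp.ne_top
  rw [Ideal.eq_top_iff_one]
  have h4 : AdjoinRoot.mk f g ∈ Q := hQ (Ideal.subset_span rfl)
  have h5 := Q.sub_mem (Q.mul_mem_left (AdjoinRoot.mk f q) h4) h3
  simpa using h5

open Polynomial in
theorem comp_sub_dvd {A : Type*} [CommRing A] (p a b : A[X]) : a - b ∣ p.comp a - p.comp b := by
  have := Polynomial.sub_dvd_eval_sub a b (p.map C)
  simpa [Polynomial.eval_map, Polynomial.comp] using this

open Polynomial in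
theorem monic_row {A κ : Type*} [CommRing A] [IsDomain A] [Fintype κ] [DecidableEq κ]
    (v a : Fin 2 ⊕ κ → A[X]) (hv : (v (.inl 0)).Monic) (ha : ∑ i, a i * v i = 1) :
    RowEq v (fun i => C ((v i).eval 0)) := by
  classical
  let I : Ideal A :=
    { carrier := {c | ∀ b d : A[X], RowEq (fun i => (v i).comp b)
        (fun i => (v i).comp (b + C c * d))}
      zero_mem' := by
        intro b d
        simpa using RowEq.refl _
      add_mem' := by
        intro c c' hc hc' b d
        have := (hc b d).trans (hc' (b + C c * d) d)
        simpa [add_mul, add_assoc] using this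
      smul_mem' := by
        intro x c hc b d
        have := hc b (C x * d)
        simpa [mul_assoc, mul_left_comm] using this }
  suffices hI : I = ⊤ by
    have h1 : (1 : A) ∈ I := by rw [hI]; trivial
    have := h1 X (-X)
    simpa [Polynomial.comp_zero] using this
  by_contra hI
  obtain ⟨m, hm, hIm⟩ := Ideal.exists_le_maximal I hI
  let _ : Field (A ⧸ m) := Ideal.Quotient.field m
  set φ := mapRingHom (Ideal.Quotient.mk m) with hφ
  have hsurj := Polynomial.map_surjective _ (Ideal.Quotient.mk_surjective (I := m))
  set c := ∑ j : κ, a (.inr j) * v (.inr j) with hc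
  have hsum : a (.inl 0) * v (.inl 0) + a (.inl 1) * v (.inl 1) + 1 * c = 1 := by
    rw [one_mul, ← ha, Fintype.sum_sum_type, Fin.sum_univ_two, hc]
  obtain ⟨h, hh⟩ := pid_stable_range (φ (v (.inl 0))) (φ (v (.inl 1))) (φ c)
    (hv.map _).ne_zero (φ (a (.inl 0))) (φ (a (.inl 1))) (φ 1) (by
      rw [← map_mul, ← map_mul, ← map_mul, ← map_add, ← map_add, hsum, map_one])
  obtain ⟨h, rfl⟩ := hsurj h
  have hh' : IsCoprime ((v (.inl 0)).map (Ideal.Quotient.mk m))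
      ((v (.inl 1) + h * c).map (Ideal.Quotient.mk m)) := by
    simpa [hφ] using hh
  obtain ⟨r, hrm, p, q, hpq⟩ := exists_resultant m _ _ hv hh'
  refine hrm (hIm ?_)
  intro b d
  let cc : Fin 2 ⊕ κ → A[X] := Sum.elim 0 (fun j => h * a (.inr j))
  have hE := RowEq.add_dot v (.inl 1) cc (by simp [cc])
  set w := v + Pi.single (.inl 1) (cc ⬝ᵥ v) with hw
  have hw0 : w (.inl 0) = v (.inl 0) := by simp [hw]
  have hw1 : w (.inl 1) = v (.inl 1) + h * c := by
    simp [hw, cc, dotProduct, hc, Finset.mul_sum, mul_assoc]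
  have hcomp : ∀ b : A[X], RowEq (fun i => (v i).comp b) (fun i => (w i).comp b) := fun b => by
    simpa [Function.comp_def] using hE.map (compRingHom b)
  refine (hcomp b).trans (RowEq.trans ?_ (hcomp _).symm)
  have hdiv : ∀ p : A[X], ∃ P, p.comp (b + C r * d) = p.comp b + C r * P := fun p => by
    obtain ⟨P, hP⟩ := comp_sub_dvd p (b + C r * d) b
    exact ⟨d * P, by linear_combination hP⟩
  choose V hV using fun i => hdiv (w i)
  obtain ⟨P, hP⟩ := hdiv p
  obtain ⟨Q, hQ⟩ := hdiv q
  have hpq' : ∀ b : A[X], p.comp b * (w (.inl 0)).comp b + q.comp b * (w (.inl 1)).comp b = C r :=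
    fun b => by
      rw [hw0, hw1, ← mul_comp, ← mul_comp, ← add_comp, hpq, C_comp]
  have := suslin_step (C r) (p.comp b) (q.comp b) P Q (fun i => (w i).comp b) V (hpq' b) (by
    rw [← hP, ← hQ, ← hV, ← hV, hpq'])
  simpa [hV] using this
end

section
open Matrix

namespace NNorm
section
open Polynomial MvPolynomial Ideal Nat RingHom List
variable {k : Type*} [Field k] {n : ℕ} (f : MvPolynomial (Fin (n + 1)) k)
variable (v w : Fin (n + 1) →₀ ℕ)

variable {f v} in
lemma lt_up (vlt : ∀ i, v i < (2 + f.totalDegree)) : ∀ l ∈ ofFn v, l < (2 + f.totalDegree) := by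
  grind

/-- We construct an algebra map `NT1 f c` which maps `X_i` into `X_i + c • X_0 ^ r_i` when `i ≠ 0`
and `X_0` to `X_0`. -/
noncomputable abbrev NT1 (c : k) :
    MvPolynomial (Fin (n + 1)) k →ₐ[k] MvPolynomial (Fin (n + 1)) k :=
  aeval fun i ↦ if i = 0 then X 0 else X i + c • X 0 ^ (2 + f.totalDegree) ^ i.1

lemma nt1_comp_nt1_neg (c : k) : (NT1 f c).comp (NT1 f (-c)) = AlgHom.id _ _ := by
  rw [comp_aeval, ← MvPolynomial.aeval_X_left]
  ext i v
  cases i using Fin.cases <;> simp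

/-- `NT1 f 1` leads to an algebra equiv `NT f`. -/
noncomputable abbrev NT := AlgEquiv.ofAlgHom (NT1 f 1) (NT1 f (-1))
  (nt1_comp_nt1_neg f 1) (by simpa using nt1_comp_nt1_neg f (-1))

lemma sum_r_mul_ne (vlt : ∀ i, v i < (2 + f.totalDegree)) (wlt : ∀ i, w i < (2 + f.totalDegree)) (ne : v ≠ w) :
    ∑ x : Fin (n + 1), (2 + f.totalDegree) ^ x.1 * v x ≠ ∑ x : Fin (n + 1), (2 + f.totalDegree) ^ x.1 * w x := by
  intro h
  refine ne <| Finsupp.ext <| congrFun <| ofFn_inj.mp ?_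
  apply ofDigits_inj_of_len_eq (Nat.lt_add_right f.totalDegree one_lt_two)
    (by simp) (lt_up vlt) (lt_up wlt)
  simpa only [ofDigits_eq_sum_mapIdx, mapIdx_eq_ofFn, get_ofFn, length_ofFn,
    Fin.val_cast, mul_comm, sum_ofFn] using! h

lemma degreeOf_zero_t {a : k} (ha : a ≠ 0) : ((NT f) (monomial v a)).degreeOf 0 =
    ∑ i : Fin (n + 1), ((2 + f.totalDegree) ^ i.1) * v i := by
  rw [← natDegree_finSuccEquiv, monomial_eq, Finsupp.prod_pow v fun a ↦ X a]
  simp only [Fin.prod_univ_succ, Fin.sum_univ_succ, map_mul, map_prod, map_pow,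
    AlgEquiv.ofAlgHom_apply, MvPolynomial.aeval_C, MvPolynomial.aeval_X, if_pos, Fin.succ_ne_zero,
    ite_false, one_smul, map_add, finSuccEquiv_X_zero, finSuccEquiv_X_succ, algebraMap_eq]
  have h (i : Fin n) :
      (Polynomial.C (X (R := k) i) + Polynomial.X ^ (2 + f.totalDegree) ^ (i.succ).1) ^ v i.succ ≠ 0 :=
    pow_ne_zero (v i.succ) (leadingCoeff_ne_zero.mp <| by simp [add_comm, leadingCoeff_X_pow_add_C])
  rw [natDegree_mul (by simp [ha]) (mul_ne_zero (by simp) (Finset.prod_ne_zero_iff.mpr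
    (fun i _ ↦ h i))), natDegree_mul (by simp) (Finset.prod_ne_zero_iff.mpr (fun i _ ↦ h i)),
    natDegree_prod _ _ (fun i _ ↦ h i), natDegree_finSuccEquiv, degreeOf_C]
  simpa only [natDegree_pow, zero_add, natDegree_X, mul_one, Fin.val_zero, pow_zero, one_mul,
    add_right_inj] using Finset.sum_congr rfl (fun i _ ↦ by
    rw [add_comm (Polynomial.C _), natDegree_X_pow_add_C, mul_comm])

/-- `NT` maps different monomials of `f` to polynomials with different degrees in `X_0`. -/
lemma degreeOf_t_ne_of_ne (hv : v ∈ f.support) (hw : w ∈ f.support) (ne : v ≠ w) :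
    (NT f <| monomial v <| coeff v f).degreeOf 0 ≠
    (NT f <| monomial w <| coeff w f).degreeOf 0 := by
  rw [degreeOf_zero_t _ _ <| mem_support_iff.mp hv, degreeOf_zero_t _ _ <| mem_support_iff.mp hw]
  refine sum_r_mul_ne f v w (fun i ↦ ?_) (fun i ↦ ?_) ne <;>
  exact lt_of_le_of_lt ((monomial_le_degreeOf i ‹_›).trans (degreeOf_le_totalDegree f i))
    (by lia)

lemma leadingCoeff_finSuccEquiv_t :
    (finSuccEquiv k n ((NT f) ((monomial v) (coeff v f)))).leadingCoeff =
    algebraMap k _ (coeff v f) := by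
  rw [monomial_eq, Finsupp.prod_fintype]
  · simp only [map_mul, map_prod, leadingCoeff_mul, leadingCoeff_prod]
    rw [AlgEquiv.ofAlgHom_apply, algHom_C, algebraMap_eq, finSuccEquiv_apply,
      eval₂Hom_C, coe_comp]
    simp only [AlgEquiv.ofAlgHom_apply, Function.comp_apply, leadingCoeff_C, map_pow,
      leadingCoeff_pow, algebraMap_eq]
    have : ∀ j, ((finSuccEquiv k n) ((NT1 f) 1 (X j))).leadingCoeff = 1 := fun j ↦ by
      by_cases h : j = 0
      · simp [h, finSuccEquiv_apply]
      · simp only [aeval_eq_bind₁, bind₁_X_right, if_neg h, one_smul, map_add, map_pow]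
        obtain ⟨i, rfl⟩ := Fin.exists_succ_eq.mpr h
        simp [finSuccEquiv_X_succ, finSuccEquiv_X_zero, add_comm]
    simp only [this, one_pow, Finset.prod_const_one, mul_one]
  exact fun i ↦ pow_zero _

/-- `NT` maps `f` into some polynomial in `X_0` such that the leading coefficient is invertible. -/
lemma T_leadingcoeff_isUnit (fne : f ≠ 0) :
    IsUnit (finSuccEquiv k n (NT f f)).leadingCoeff := by
  obtain ⟨v, vin, vs⟩ := Finset.exists_max_image f.support
    (fun v ↦ (NT f ((monomial v) (coeff v f))).degreeOf 0) (support_nonempty.mpr fne)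
  set h := fun w ↦ (MvPolynomial.monomial w) (coeff w f)
  simp only [← natDegree_finSuccEquiv] at vs
  replace vs : ∀ x ∈ f.support \ {v}, (finSuccEquiv k n ((NT f) (h x))).degree <
      (finSuccEquiv k n ((NT f) (h v))).degree := by
    intro x hx
    obtain ⟨h1, h2⟩ := Finset.mem_sdiff.mp hx
    apply degree_lt_degree <| lt_of_le_of_ne (vs x h1) ?_
    simpa only [natDegree_finSuccEquiv]
      using degreeOf_t_ne_of_ne f _ _ h1 vin <| ne_of_not_mem_cons h2
  have coeff : (finSuccEquiv k n ((NT f) (h v + ∑ x ∈ f.support \ {v}, h x))).leadingCoeff =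
      (finSuccEquiv k n ((NT f) (h v))).leadingCoeff := by
    simp only [map_add, map_sum]
    rw [add_comm]
    apply leadingCoeff_add_of_degree_lt <| (lt_of_le_of_lt <| degree_sum_le _ _) ?_
    have h2 : h v ≠ 0 := by simpa [h] using mem_support_iff.mp vin
    replace h2 : (finSuccEquiv k n ((NT f) (h v))) ≠ 0 := fun eq ↦ h2 <|
      by simpa only [map_eq_zero_iff _ (AlgEquiv.injective _)] using eq
    exact (Finset.sup_lt_iff <| Ne.bot_lt (fun x ↦ h2 <| degree_eq_bot.mp x)).mpr vs
  nth_rw 2 [← f.support_sum_monomial_coeff]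
  rw [Finset.sum_eq_add_sum_sdiff_singleton_of_mem vin h]
  rw [leadingCoeff_finSuccEquiv_t] at coeff
  simpa only [coeff, algebraMap_eq] using (mem_support_iff.mp vin).isUnit.map MvPolynomial.C

end
end NNorm
end

section
open Matrix

/-- every unimodular row is completable -/
def HermiteRing (R : Type*) [CommRing R] : Prop :=
  ∀ (ι : Type) [Fintype ι] [DecidableEq ι] (v a : ι → R), ∑ i, a i * v i = 1 →
    ∀ i, RowEq v (Pi.single i 1)

theorem comp_single_one {ι R S : Type*} [DecidableEq ι] [CommRing R] [CommRing S] (φ : R →+* S)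
    (i : ι) : φ ∘ (Pi.single i 1 : ι → R) = Pi.single i 1 := by
  ext j
  by_cases h : j = i
  · subst h; simp
  · simp [h]

theorem HermiteRing.of_equiv {R S : Type*} [CommRing R] [CommRing S] (e : R ≃+* S)
    (h : HermiteRing S) : HermiteRing R := by
  intro ι _ _ v a ha i
  apply RowEq.of_map_equiv e
  have := h ι (e ∘ v) (e ∘ a) (by simpa using congrArg e ha) i
  have h2 := comp_single_one (e : R →+* S) i
  simp only [RingEquiv.coe_toRingHom] at h2
  rwa [h2]

theorem HermiteRing.field (k : Type*) [Field k] : HermiteRing k := by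
  intro ι _ _ v a ha i
  obtain ⟨j, -, hj⟩ := Finset.exists_ne_zero_of_sum_ne_zero (ha.trans_ne one_ne_zero)
  exact RowEq.of_unit v j i (right_ne_zero_of_mul hj).isUnit

theorem hermite_mvPolynomial (k : Type*) [Field k] (n : ℕ) :
    HermiteRing (MvPolynomial (Fin n) k) := by
  induction n with
  | zero => exact (HermiteRing.field k).of_equiv (MvPolynomial.isEmptyAlgEquiv k (Fin 0)).toRingEquiv
  | succ n ih =>
    intro ι _ _ v a ha i
    obtain ⟨j, -, hj⟩ := Finset.exists_ne_zero_of_sum_ne_zero (ha.trans_ne one_ne_zero)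
    have hvj := right_ne_zero_of_mul hj
    by_cases hcard : Fintype.card ι ≤ 1
    · have := Fintype.card_le_one_iff_subsingleton.1 hcard
      rw [Fintype.sum_subsingleton _ i] at ha
      exact RowEq.of_unit v i i (IsUnit.of_mul_eq_one_right _ ha)
    obtain ⟨m, hm⟩ : ∃ m, Fintype.card ι = 2 + m := ⟨Fintype.card ι - 2, by omega⟩
    have e0 : Fin 2 ⊕ Fin m ≃ ι := Fintype.equivOfCardEq (by simp [hm])
    obtain ⟨e, he⟩ : ∃ e : Fin 2 ⊕ Fin m ≃ ι, e (.inl 0) = j :=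
      ⟨e0.trans (Equiv.swap (e0 (.inl 0)) j), by simp⟩
    let Φ : MvPolynomial (Fin (n+1)) k ≃+* Polynomial (MvPolynomial (Fin n) k) :=
      ((NNorm.NT (v j)).trans (MvPolynomial.finSuccEquiv k n)).toRingEquiv
    have hΦ : IsUnit (Φ (v j)).leadingCoeff := NNorm.T_leadingcoeff_isUnit (v j) hvj
    obtain ⟨u, hu⟩ := hΦ
    let U : (Polynomial (MvPolynomial (Fin n) k))ˣ := Units.map (Polynomial.C : MvPolynomial (Fin n) k →+* _).toMonoidHom u⁻¹
    have hU : (U : Polynomial (MvPolynomial (Fin n) k)) = Polynomial.C ((u⁻¹ : (MvPolynomial (Fin n) k)ˣ) : MvPolynomial (Fin n) k) := rfl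
    apply RowEq.of_map_equiv Φ
    apply RowEq.reindex e
    set w : Fin 2 ⊕ Fin m → Polynomial (MvPolynomial (Fin n) k) :=
      fun i => (U : Polynomial (MvPolynomial (Fin n) k)) * Φ (v (e i)) with hw
    have h1 : RowEq ((Φ ∘ v) ∘ e) w := RowEq.smul U _
    have hsum : ∑ i, (((U⁻¹ : _ˣ) : Polynomial (MvPolynomial (Fin n) k)) * Φ (a (e i))) * w i = 1 := by
      have h3 := congrArg Φ ha
      rw [map_sum, map_one, ← e.sum_comp] at h3
      rw [← h3]
      refine Finset.sum_congr rfl fun i _ => ?_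
      rw [map_mul, hw]
      linear_combination (Φ (a (e i)) * Φ (v (e i))) * U.inv_mul
    have h2 := monic_row w _ (by
      rw [Polynomial.Monic, hw]
      simp only [he]
      rw [hU, Polynomial.leadingCoeff_mul, Polynomial.leadingCoeff_C, ← hu, Units.inv_mul]) hsum
    have h4 := (ih (Fin 2 ⊕ Fin m) (fun i => (w i).eval 0) _ (by
      have := congrArg (Polynomial.eval 0) hsum
      simpa only [Polynomial.eval_finset_sum, Polynomial.eval_mul, Polynomial.eval_one] using this)
        (e.symm i)).map Polynomial.C
    rw [comp_single_one] at h4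
    refine (h1.trans h2).trans (h4.trans ?_)
    have h5 := comp_single_one (Φ : MvPolynomial (Fin (n+1)) k →+* Polynomial (MvPolynomial (Fin n) k)) i
    simp only [RingEquiv.coe_toRingHom] at h5
    rw [h5]
    have h6 : (Pi.single i 1 : ι → Polynomial (MvPolynomial (Fin n) k)) ∘ e =
        Pi.single (e.symm i) 1 := by
      ext1 j
      by_cases h : j = e.symm i
      · subst h; simp
      rw [Function.comp_apply, Pi.single_eq_of_ne h, Pi.single_eq_of_ne]
      rintro rfl; simp at h
    rw [h6]
    exact RowEq.refl _

/-- stably free modules over a Hermite ring are free -/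
theorem HermiteRing.free_of_prod {R : Type*} [CommRing R] (hR : HermiteRing R) (M : Type*)
    [AddCommGroup M] [Module R M] (q : ℕ) (e : (M × R) ≃ₗ[R] (Fin q → R)) : Module.Free R M := by
  -- the projection to `R` is a unimodular row
  let π : (Fin q → R) →ₗ[R] R := LinearMap.snd R M R ∘ₗ e.symm.toLinearMap
  let v : Fin q → R := fun i => π (Pi.single i 1)
  have hπ : ∀ x, π x = ∑ i, x i * v i := by
    intro x
    conv_lhs => rw [pi_eq_sum_univ' x]
    simp only [map_sum, map_smul, v, smul_eq_mul]
  have h1 : ∑ i, e (0, 1) i * v i = 1 := by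
    rw [← hπ]; simp [π]
  rcases q with _ | q
  · have : Subsingleton (M × R) := e.toEquiv.subsingleton
    have : Subsingleton M := (Prod.fst_surjective (α := M) (β := R)).subsingleton
    infer_instance
  obtain ⟨g, hg⟩ := hR (Fin (q+1)) v _ h1 0
  -- x ↦ x * g⁻¹ 
  let G : (Fin (q+1) → R) ≃ₗ[R] (Fin (q+1) → R) :=
    LinearEquiv.ofLinearMap (Matrix.vecMulLinear g.1) (Matrix.vecMulLinear (g⁻¹).1)
      (LinearMap.ext fun x => by
        simp only [LinearMap.comp_apply, Matrix.vecMulLinear_apply, Matrix.vecMul_vecMul]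
        simp)
      (LinearMap.ext fun x => by
        simp only [LinearMap.comp_apply, Matrix.vecMulLinear_apply, Matrix.vecMul_vecMul]
        simp)
  have hG : ∀ x, π (G x) = x 0 := by
    intro x
    rw [hπ]
    change (x ᵥ* g.1) ⬝ᵥ v = x 0
    rw [← Matrix.dotProduct_mulVec, hg]
    simp
  let H := e.trans G.symm
  have hH : ∀ m r, H (m, r) 0 = r := by
    intro m r
    rw [← hG (H (m, r))]
    simp [H, π]
  let F : M →ₗ[R] (Fin q → R) :=
    LinearMap.pi (fun i => LinearMap.proj i.succ) ∘ₗ H.toLinearMap ∘ₗ LinearMap.inl R M R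
  have hF : ∀ m i, F m i = H (m, 0) i.succ := fun m i => rfl
  have hb : Function.Bijective F := by
    constructor
    · rw [injective_iff_map_eq_zero]
      intro m hm
      have : H (m, 0) = 0 := by
        ext i
        refine Fin.cases (hH m 0) (fun i => ?_) i
        rw [← hF, hm]; rfl
      rw [map_eq_zero_iff _ H.injective] at this
      exact congrArg Prod.fst this
    · intro y
      obtain ⟨⟨m, r⟩, hx⟩ := H.surjective (Fin.cons 0 y)
      have hr : r = 0 := by rw [← hH m r, hx]; rfl
      subst hr
      exact ⟨m, by ext i; rw [hF, hx]; simp⟩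
  exact Module.Free.of_equiv (LinearEquiv.ofBijective F hb).symm

theorem HermiteRing.free_of_prod_pow {R : Type*} [CommRing R] (hR : HermiteRing R) (p : ℕ)
    (M : Type*) [AddCommGroup M] [Module R M] (q : ℕ) (e : (M × (Fin p → R)) ≃ₗ[R] (Fin q → R)) :
    Module.Free R M := by
  cases subsingleton_or_nontrivial R
  · have := Module.subsingleton R M
    infer_instance
  induction p generalizing q with
  | zero => exact Module.Free.of_equiv (e.symm.trans LinearEquiv.prodUnique)
  | succ p ih =>
    have e' : ((M × (Fin p → R)) × R) ≃ₗ[R] (Fin q → R) :=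
      ((LinearEquiv.prodAssoc R M (Fin p → R) R).trans
        (LinearEquiv.prodCongr (LinearEquiv.refl R M)
          ((LinearEquiv.prodComm R _ _).trans (Fin.consLinearEquiv R (fun _ : Fin (p+1) => R))))).trans e
    have hfree := hR.free_of_prod _ q e'
    have hfin : Module.Finite R ((M × (Fin p → R)) × R) := Module.Finite.equiv e'.symm
    have hfin' : Module.Finite R (M × (Fin p → R)) :=
      Module.Finite.of_surjective (LinearMap.fst R _ R) Prod.fst_surjective
    exact ih _ (Module.finBasis R (M × (Fin p → R))).equivFun
end

/-- `Sfd R d M`: `M` has a resolution of length `d` by finite free modules, ending in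
a stably free module. -/
def Sfd (R : Type) [CommRing R] : ∀ (_ : ℕ) (M : Type) [AddCommGroup M] [Module R M], Prop
  | 0, M, _, _ => ∃ (P : Type) (_ : AddCommGroup P) (_ : Module R P),
      Module.Finite R P ∧ Module.Free R P ∧ Module.Finite R (M × P) ∧ Module.Free R (M × P)
  | d + 1, M, _, _ => ∃ (F : Type) (_ : AddCommGroup F) (_ : Module R F) (f : F →ₗ[R] M),
      Module.Finite R F ∧ Module.Free R F ∧ Function.Surjective f ∧ Sfd R d (LinearMap.ker f)

namespace Sfd
variable {R : Type} [CommRing R] {d : ℕ} {A B C M N : Type}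
  [AddCommGroup A] [Module R A] [AddCommGroup B] [Module R B] [AddCommGroup C] [Module R C]
  [AddCommGroup M] [Module R M] [AddCommGroup N] [Module R N]

theorem equiv (e : M ≃ₗ[R] N) (h : Sfd R d M) : Sfd R d N := by
  cases d with
  | zero =>
    obtain ⟨P, _, _, h1, h2, h3, h4⟩ := h
    exact ⟨P, _, _, h1, h2, Module.Finite.equiv (e.prodCongr (LinearEquiv.refl R P)),
      Module.Free.of_equiv (e.prodCongr (LinearEquiv.refl R P))⟩
  | succ d =>
    obtain ⟨F, _, _, f, h1, h2, h3, h4⟩ := h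
    refine ⟨F, _, _, e.toLinearMap ∘ₗ f, h1, h2, e.surjective.comp h3, ?_⟩
    rw [LinearEquiv.ker_comp]
    exact h4

/-- transport along a ring isomorphism -/
theorem transport {S : Type} [CommRing S] (e : R ≃+* S) (d : ℕ) (M N : Type) [AddCommGroup M]
    [Module R M] [AddCommGroup N] [Module S N] (ε : M ≃+ N)
    (hε : ∀ (r : R) (m : M), ε (r • m) = e r • ε m) (h : Sfd R d M) : Sfd S d N := by
  have key : ∀ (P Q : Type) [AddCommGroup P] [Module R P] [AddCommGroup Q] [Module S Q] (ε : P ≃+ Q)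
      (hε : ∀ (r : R) (m : P), ε (r • m) = e r • ε m), Module.Finite R P → Module.Free R P →
      Module.Finite S Q ∧ Module.Free S Q := by
    intro P Q _ _ _ _ ε hε h1 h2
    let _ : RingHomInvPair (e : R →+* S) (e.symm : S →+* R) := RingHomInvPair.of_ringEquiv e
    let _ : RingHomInvPair (e.symm : S →+* R) (e : R →+* S) := RingHomInvPair.of_ringEquiv e.symm
    let E : P ≃ₛₗ[(e : R →+* S)] Q := { ε with map_smul' := hε }
    exact ⟨Module.Finite.of_surjective E.toLinearMap E.surjective, Module.Free.of_equiv E⟩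
  induction d generalizing M N with
  | zero =>
    obtain ⟨P, _, _, h1, h2, h3, h4⟩ := h
    let _ : Module S P := Module.compHom P (e.symm : S →+* R)
    have hP : ∀ (r : R) (p : P), r • p = e r • p := fun r p => by
      change _ = (e.symm (e r)) • p
      simp
    obtain ⟨h5, h6⟩ := key P P (AddEquiv.refl P) hP h1 h2
    obtain ⟨h7, h8⟩ := key (M × P) (N × P) (ε.prodCongr (AddEquiv.refl P))
      (fun r m => Prod.ext (hε r m.1) (hP r m.2)) h3 h4
    exact ⟨P, _, _, h5, h6, h7, h8⟩
  | succ d ih =>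
    obtain ⟨P, _, _, f, h1, h2, h3, h4⟩ := h
    let _ : Module S P := Module.compHom P (e.symm : S →+* R)
    have hP : ∀ (r : R) (p : P), r • p = e r • p := fun r p => by
      change _ = (e.symm (e r)) • p
      simp
    obtain ⟨h5, h6⟩ := key P P (AddEquiv.refl P) hP h1 h2
    let g : P →ₗ[S] N :=
      { toFun := fun p => ε (f p)
        map_add' := by simp
        map_smul' := by
          intro s p
          obtain ⟨r, rfl⟩ := e.surjective s
          rw [← hP, map_smul, hε]; rfl }
    refine ⟨P, _, _, g, h5, h6, ε.surjective.comp h3, ?_⟩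
    have hk : ∀ x, x ∈ LinearMap.ker f ↔ x ∈ LinearMap.ker g := by
      intro x; simp [g]
    refine ih (LinearMap.ker f) (LinearMap.ker g)
      { toFun := fun x => ⟨x.1, (hk _).1 x.2⟩
        invFun := fun x => ⟨x.1, (hk _).2 x.2⟩
        left_inv := fun x => rfl
        right_inv := fun x => rfl
        map_add' := fun x y => rfl } ?_ h4
    intro r x
    exact Subtype.ext (hP r x.1)

theorem zero_of_free [Module.Finite R M] [Module.Free R M] : Sfd R 0 M :=
  ⟨PUnit, _, _, inferInstance, inferInstance, inferInstance, inferInstance⟩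

theorem projective (h : Sfd R 0 M) : Module.Projective R M := by
  obtain ⟨P, _, _, h1, h2, h3, h4⟩ := h
  exact Module.Projective.of_split (LinearMap.inl R M P) (LinearMap.fst R M P) (by ext; simp)

theorem succ (h : Sfd R d M) : Sfd R (d + 1) M := by
  induction d generalizing M with
  | zero =>
    obtain ⟨P, _, _, h1, h2, h3, h4⟩ := h
    refine ⟨M × P, _, _, LinearMap.fst R M P, h3, h4, Prod.fst_surjective, ?_⟩
    have : Function.Injective (LinearMap.inr R M P) := LinearMap.inr_injective
    rw [LinearMap.ker_fst]
    exact zero_of_free.equiv (LinearEquiv.ofInjective _ this)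
  | succ d ih =>
    obtain ⟨F, _, _, f, h1, h2, h3, h4⟩ := h
    exact ⟨F, _, _, f, h1, h2, h3, ih h4⟩

theorem of_free [Module.Finite R M] [Module.Free R M] (d : ℕ) : Sfd R d M := by
  induction d with
  | zero => exact zero_of_free
  | succ d ih => exact ih.succ

theorem ext (i : A →ₗ[R] B) (s : B →ₗ[R] C) (hi : Function.Injective i)
    (hs : Function.Surjective s) (he : Function.Exact i s) (hA : Sfd R d A) (hC : Sfd R d C) :
    Sfd R d B := by
  induction d generalizing A B C with
  | zero =>
    have hp := hC.projective
    obtain ⟨t, ht⟩ := Module.projective_lifting_property s LinearMap.id hs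
    let E : (A × C) →ₗ[R] B := i.coprod t
    have ht' : ∀ c, s (t c) = c := fun c => LinearMap.congr_fun ht c
    have hsi : ∀ a, s (i a) = 0 := fun a => he.apply_apply_eq_zero a
    have hE : Function.Bijective E := by
      constructor
      · rw [injective_iff_map_eq_zero]
        rintro ⟨a, c⟩ h
        have h' : i a + t c = 0 := by simpa [E] using h
        have hc : c = 0 := by simpa [hsi, ht'] using congrArg s h'
        subst hc
        have : a = 0 := hi (by simpa using h')
        simp [this]
      · intro b
        obtain ⟨a, ha⟩ := (he (b - t (s b))).1 (by simp [ht'])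
        exact ⟨(a, s b), by simp [E, ha]⟩
    obtain ⟨P, _, _, h1, h2, h3, h4⟩ := hA
    obtain ⟨P', _, _, h1', h2', h3', h4'⟩ := hC
    let e : ((A × P) × (C × P')) ≃ₗ[R] B × (P × P') :=
      (LinearEquiv.prodProdProdComm R A P C P').trans
        ((LinearEquiv.ofBijective E hE).prodCongr (LinearEquiv.refl R _))
    exact ⟨P × P', _, _, inferInstance, inferInstance, Module.Finite.equiv e,
      Module.Free.of_equiv e⟩
  | succ d ih =>
    obtain ⟨F, _, _, f, h1, h2, h3, h4⟩ := hA
    obtain ⟨F', _, _, f', h1', h2', h3', h4'⟩ := hC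
    obtain ⟨t, ht⟩ := Module.projective_lifting_property s f' hs
    have ht' : ∀ c, s (t c) = f' c := fun c => LinearMap.congr_fun ht c
    have hsi : ∀ a, s (i a) = 0 := fun a => he.apply_apply_eq_zero a
    let E : (F × F') →ₗ[R] B := (i ∘ₗ f).coprod t
    have hE : ∀ x y, E (x, y) = i (f x) + t y := fun x y => by simp [E]
    have hker : ∀ x y, E (x, y) = 0 → f' y = 0 := fun x y h => by
      have := congrArg s h
      simpa [hE, hsi, ht'] using this
    refine ⟨F × F', _, _, E, inferInstance, inferInstance, ?_, ?_⟩
    · intro b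
      obtain ⟨y, hy⟩ := h3' (s b)
      obtain ⟨a, ha⟩ := (he (b - t y)).1 (by simp [ht', hy])
      obtain ⟨x, rfl⟩ := h3 a
      exact ⟨(x, y), by simp [hE, ha]⟩
    · refine ih (A := LinearMap.ker f) (C := LinearMap.ker f')
        (LinearMap.codRestrict _ (LinearMap.inl R F F' ∘ₗ (LinearMap.ker f).subtype) ?_)
        (LinearMap.codRestrict _ (LinearMap.snd R F F' ∘ₗ (LinearMap.ker E).subtype) ?_)
        ?_ ?_ ?_ h4 h4'
      · rintro ⟨x, hx⟩
        rw [LinearMap.mem_ker] at hx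
        simp [hE, hx]
      · rintro ⟨⟨x, y⟩, hx⟩
        exact hker x y hx
      · rintro ⟨x, hx⟩ ⟨y, hy⟩ h
        simpa [Subtype.ext_iff] using h
      · rintro ⟨y, hy⟩
        obtain ⟨a, ha⟩ := (he (t y)).1 (by rw [ht']; exact hy)
        obtain ⟨x, rfl⟩ := h3 a
        refine ⟨⟨(-x, y), ?_⟩, ?_⟩
        · rw [LinearMap.mem_ker, hE, map_neg, map_neg, ha]; simp
        · simp [Subtype.ext_iff]
      · rintro ⟨⟨x, y⟩, hx⟩
        constructor
        · intro h
          have hy : y = 0 := by simpa [Subtype.ext_iff] using h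
          subst hy
          rw [LinearMap.mem_ker, hE, map_zero, add_zero] at hx
          exact ⟨⟨x, hi (by simpa using hx)⟩, by simp [Subtype.ext_iff]⟩
        · rintro ⟨⟨x', hx'⟩, h⟩
          have : x' = x ∧ 0 = y := by simpa [Subtype.ext_iff] using h
          simp [Subtype.ext_iff, ← this.2]

theorem quot (i : A →ₗ[R] B) (s : B →ₗ[R] C) (hi : Function.Injective i)
    (hs : Function.Surjective s) (he : Function.Exact i s) (hA : Sfd R d A)
    (hB : Sfd R (d + 1) B) : Sfd R (d + 1) C := by
  obtain ⟨F, _, _, f, h1, h2, h3, h4⟩ := hB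
  refine ⟨F, _, _, s ∘ₗ f, h1, h2, hs.comp h3, ?_⟩
  have hsi : ∀ a, s (i a) = 0 := fun a => he.apply_apply_eq_zero a
  let eA := LinearEquiv.ofInjective i hi
  have hr : ∀ x : LinearMap.ker (s ∘ₗ f), f x.1 ∈ LinearMap.range i := fun x => (he _).1 x.2
  refine ext (A := LinearMap.ker f) (C := LinearMap.range i)
    (Submodule.inclusion (LinearMap.ker_le_ker_comp f s))
    (LinearMap.codRestrict _ (f ∘ₗ (LinearMap.ker (s ∘ₗ f)).subtype) hr)
    (Submodule.inclusion_injective _) ?_ ?_ h4 (hA.equiv eA)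
  · rintro ⟨_, a, rfl⟩
    obtain ⟨x, hx⟩ := h3 (i a)
    exact ⟨⟨x, by simp [hx, hsi]⟩, Subtype.ext hx⟩
  · rintro ⟨x, hx⟩
    constructor
    · intro h
      exact ⟨⟨x, (congrArg Subtype.val h : f x = 0)⟩, rfl⟩
    · rintro ⟨⟨y, hy⟩, h⟩
      have : y = x := congrArg Subtype.val h
      subst this
      exact Subtype.ext hy

theorem cancel (P : Type) [AddCommGroup P] [Module R P] [Module.Finite R P] [Module.Free R P]
    (h : Sfd R d (M × P)) : Sfd R d M := by
  cases d with
  | zero =>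
    obtain ⟨Q, _, _, h1, h2, h3, h4⟩ := h
    let e := LinearEquiv.prodAssoc R M P Q
    exact ⟨P × Q, _, _, inferInstance, inferInstance, Module.Finite.equiv e,
      Module.Free.of_equiv e⟩
  | succ d =>
    refine quot (LinearMap.inr R M P) (LinearMap.fst R M P) LinearMap.inr_injective
      Prod.fst_surjective ?_ (of_free d) h
    exact Function.Exact.inr_fst

/-- Schanuel -/
theorem ker {F : Type} [AddCommGroup F] [Module R F] [Module.Finite R F] [Module.Free R F]
    (f : F →ₗ[R] M) (hf : Function.Surjective f) (h : Sfd R (d + 1) M) :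
    Sfd R d (LinearMap.ker f) := by
  obtain ⟨G, _, _, g, h1, h2, h3, h4⟩ := h
  obtain ⟨a, ha⟩ := Module.projective_lifting_property f g hf
  obtain ⟨b, hb⟩ := Module.projective_lifting_property g f h3
  have ha : ∀ x, f (a x) = g x := fun c => LinearMap.congr_fun ha c
  have hb : ∀ x, g (b x) = f x := fun c => LinearMap.congr_fun hb c
  -- the kernel of `F × G → M` is isomorphic to both
  have h5 : Sfd R d (LinearMap.ker g × F) :=
    ext (LinearMap.inl R _ _) (LinearMap.snd R _ _) LinearMap.inl_injective Prod.snd_surjective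
      Function.Exact.inl_snd h4 (of_free d)
  apply cancel G
  refine h5.equiv ?_
  refine LinearEquiv.ofLinearMap
    (LinearMap.prod (LinearMap.codRestrict _
      (LinearMap.snd R _ _ - a ∘ₗ (b ∘ₗ LinearMap.snd R _ _ + (LinearMap.ker g).subtype ∘ₗ LinearMap.fst R _ _)) ?_)
      (b ∘ₗ LinearMap.snd R _ _ + (LinearMap.ker g).subtype ∘ₗ LinearMap.fst R _ _))
    (LinearMap.prod (LinearMap.codRestrict _
      (LinearMap.snd R _ _ - b ∘ₗ (a ∘ₗ LinearMap.snd R _ _ + (LinearMap.ker f).subtype ∘ₗ LinearMap.fst R _ _)) ?_)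
      (a ∘ₗ LinearMap.snd R _ _ + (LinearMap.ker f).subtype ∘ₗ LinearMap.fst R _ _)) ?_ ?_
  · rintro ⟨⟨x, hx⟩, y⟩
    rw [LinearMap.mem_ker] at hx
    simp [ha, hb, hx]
  · rintro ⟨⟨x, hx⟩, y⟩
    rw [LinearMap.mem_ker] at hx
    simp [ha, hb, hx]
  · apply LinearMap.ext
    rintro ⟨⟨x, hx⟩, y⟩
    simp [Prod.ext_iff, Subtype.ext_iff]
  · apply LinearMap.ext
    rintro ⟨⟨x, hx⟩, y⟩
    simp [Prod.ext_iff, Subtype.ext_iff]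

end Sfd

open Polynomial TensorProduct in
theorem Sfd.baseChange {A : Type} [CommRing A] {d : ℕ} {M : Type} [AddCommGroup M] [Module A M]
    (h : Sfd A d M) : Sfd A[X] d (A[X] ⊗[A] M) := by
  induction d generalizing M with
  | zero =>
    obtain ⟨P, _, _, h1, h2, h3, h4⟩ := h
    let e := TensorProduct.prodRight A A[X] A[X] M P
    exact ⟨A[X] ⊗[A] P, _, _, inferInstance, inferInstance, Module.Finite.equiv e,
      Module.Free.of_equiv e⟩
  | succ d ih =>
    obtain ⟨F, _, _, f, h1, h2, h3, h4⟩ := h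
    refine ⟨A[X] ⊗[A] F, _, _, f.baseChange A[X], inferInstance, inferInstance,
      LinearMap.lTensor_surjective _ h3, ?_⟩
    have hinj : Function.Injective ((LinearMap.ker f).subtype.baseChange A[X]) :=
      Module.Flat.lTensor_preserves_injective_linearMap _ (Submodule.subtype_injective _)
    have hex : Function.Exact ((LinearMap.ker f).subtype.baseChange A[X]) (f.baseChange A[X]) :=
      lTensor_exact A[X] (LinearMap.exact_subtype_ker_map f) h3
    rw [hex.linearMap_ker_eq]
    exact (ih h4).equiv (LinearEquiv.ofInjective _ hinj)

namespace SwanSeq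
open Polynomial PolynomialModule

variable {A : Type} [CommRing A] {M : Type} [AddCommGroup M] [Module A M] [Module A[X] M]
  [IsScalarTower A A[X] M] {N : Type} [AddCommGroup N] [Module A N]

/-- extension of an `A`-linear map to polynomial modules -/
noncomputable def theta (j : N →ₗ[A] M) : PolynomialModule A N →ₗ[A[X]] M :=
  (j.liftBaseChange A[X]) ∘ₗ (polynomialTensorProductLEquivPolynomialModule A N).symm.toLinearMap

theorem theta_single (j : N →ₗ[A] M) (i : ℕ) (n : N) :
    theta j (single A i n) = (X ^ i : A[X]) • j n := by
  have : single A i n = (X ^ i : A[X]) • polynomialTensorProductLEquivPolynomialModule A N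
      (1 ⊗ₜ n) := by
    simp only [polynomialTensorProductLEquivPolynomialModule]
    simp [← monomial_one_right_eq_X_pow]
    rfl
  rw [theta, LinearMap.comp_apply, this, _root_.map_smul, _root_.map_smul, LinearEquiv.coe_coe,
    LinearEquiv.symm_apply_apply]
  simp

theorem coeff_sub' (x y : PolynomialModule A N) (i : ℕ) :
    (x - y).coeff i = x.coeff i - y.coeff i := by
  rw [eq_sub_iff_add_eq]
  rw [← Finsupp.add_apply, ← PolynomialModule.coeff_add, sub_add_cancel]

theorem coeff_single' (i j : ℕ) (n : N) :
    (single A i n).coeff j = if i = j then n else 0 := by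
  rw [coeff_single, Finsupp.single_apply]

theorem single_sum (y : PolynomialModule A N) (B : ℕ) (hB : ∀ i, B ≤ i → y.coeff i = 0) :
    y = ∑ i ∈ Finset.range B, single A i (y.coeff i) := by
  apply PolynomialModule.coeff_injective
  ext n
  simp only [PolynomialModule.coeff_sum, coeff_single, Finsupp.finsetSum_apply, Finsupp.single_apply]
  rw [Finset.sum_ite_eq' (Finset.range B) n]
  split_ifs with h
  · rfl
  · exact hB n (by simpa using h)

theorem theta_apply (j : N →ₗ[A] M) (y : PolynomialModule A N) (B : ℕ)
    (hB : ∀ i, B ≤ i → y.coeff i = 0) :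
    theta j y = ∑ i ∈ Finset.range B, (X ^ i : A[X]) • j (y.coeff i) := by
  conv_lhs => rw [single_sum y B hB]
  simp [map_sum, theta_single]

theorem exists_bound (y : PolynomialModule A N) : ∃ B, ∀ i, B ≤ i → y.coeff i = 0 := by
  refine ⟨y.coeff.support.sup id + 1, fun i hi => ?_⟩
  by_contra h
  have : i ≤ y.coeff.support.sup id := Finset.le_sup (f := id) (by simpa using h)
  omega

variable (L K : Submodule A M) (hLK : L ≤ K) (hX : ∀ x ∈ L, (X : A[X]) • x ∈ K)

/-- multiplication by `X` -/
noncomputable def mulX : L →ₗ[A] K :=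
  LinearMap.codRestrict K ((Module.toModuleEnd A (S := A[X]) M X) ∘ₗ L.subtype) (fun x => hX x.1 x.2)

/-- the first map of the sequence -/
noncomputable def delta : PolynomialModule A L →ₗ[A[X]] PolynomialModule A K :=
  theta (lsingle A 0 ∘ₗ mulX L K hX - lsingle A 1 ∘ₗ Submodule.inclusion hLK)

theorem delta_single (i : ℕ) (l : L) : delta L K hLK hX (single A i l) =
    single A i (mulX L K hX l) - single A (i + 1) (Submodule.inclusion hLK l) := by
  rw [delta, theta_single, LinearMap.sub_apply, smul_sub, ← monomial_one_right_eq_X_pow]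
  simp [monomial_smul_lsingle, lsingle, monomial_smul_single]

theorem delta_coeff_succ (x : PolynomialModule A L) (i : ℕ) :
    (delta L K hLK hX x).coeff (i + 1) = mulX L K hX (x.coeff (i + 1)) -
      Submodule.inclusion hLK (x.coeff i) := by
  induction x using PolynomialModule.induction_linear with
  | zero => simp
  | add x y hx hy => simp [hx, hy]; abel
  | single n l =>
    rw [delta_single, coeff_sub', coeff_single', coeff_single', coeff_single', coeff_single']
    split_ifs <;> first | omega | simp

theorem delta_injective : Function.Injective (delta L K hLK hX) := by
  rw [injective_iff_map_eq_zero]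
  intro x hx
  obtain ⟨B, hB⟩ := exists_bound x
  have h1 : ∀ i, x.coeff (i + 1) = 0 → x.coeff i = 0 := by
    intro i hi
    have := delta_coeff_succ L K hLK hX x i
    rw [hx, hi] at this
    have h3 : Submodule.inclusion hLK (x.coeff i) = 0 := by simpa using this
    exact (map_eq_zero_iff _ (Submodule.inclusion_injective hLK)).1 h3
  have h2 : ∀ j i, B ≤ i + j → x.coeff i = 0 := by
    intro j
    induction j with
    | zero => exact fun i hi => hB i hi
    | succ j ih => exact fun i hi => h1 i (ih (i + 1) (by omega))
  apply PolynomialModule.coeff_injective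
  ext i
  rw [h2 B i (by omega)]; rfl

theorem theta_delta (x : PolynomialModule A L) : theta K.subtype (delta L K hLK hX x) = 0 := by
  induction x using PolynomialModule.induction_linear with
  | zero => simp
  | add x y hx hy => simp [hx, hy]
  | single n l =>
    rw [delta_single, map_sub, theta_single, theta_single]
    simp [mulX, pow_succ, mul_smul]

theorem exact (hstar : ∀ (y : PolynomialModule A K) (B : ℕ), (∀ i, B + 2 ≤ i → y.coeff i = 0) →
      theta K.subtype y = 0 → (y.coeff (B + 1) : M) ∈ L) :
    Function.Exact (delta L K hLK hX) (theta K.subtype) := by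
  intro y
  refine ⟨fun h => ?_, ?_⟩
  swap
  · rintro ⟨x, rfl⟩; exact theta_delta L K hLK hX x
  obtain ⟨B, hB⟩ := exists_bound y
  induction B generalizing y with
  | zero =>
    refine ⟨0, ?_⟩
    apply PolynomialModule.coeff_injective
    ext i
    simp [hB i (by omega)]
  | succ B ih =>
    rcases B with _ | B
    · apply ih _ h
      intro i hi
      rcases i with _ | i
      · rw [theta_apply _ _ _ hB] at h
        simpa using h
      · exact hB _ (by omega)
    · have hl := hstar y B hB h
      let l : L := ⟨_, hl⟩
      obtain ⟨x, hx⟩ := ih (y + delta L K hLK hX (single A B l))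
        (by rw [map_add, h, theta_delta, add_zero]) (by
          intro i hi
          rw [delta_single]
          by_cases hi' : i = B + 1
          · subst hi'
            rw [PolynomialModule.coeff_add, Finsupp.add_apply, coeff_sub', coeff_single', coeff_single',
              if_neg (by omega), if_pos rfl]
            simp [l, Subtype.ext_iff]
          · have hBi : B ≠ i := by omega
            have hBi' : B + 1 ≠ i := by omega
            rw [PolynomialModule.coeff_add, Finsupp.add_apply, coeff_sub', coeff_single', coeff_single',
              if_neg hBi, if_neg hBi', hB i (by omega)]
            simp)
      exact ⟨x - single A B l, by rw [map_sub, hx]; simp⟩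

end SwanSeq

namespace SwanSeq
open Polynomial PolynomialModule

section
variable {A : Type} [CommRing A]

/-- vectors of polynomials of degree `< n` -/
noncomputable def GG (A : Type) [CommRing A] (m n : ℕ) : Submodule A (Fin m → A[X]) :=
  Submodule.pi Set.univ (fun _ => degreeLT A n)

theorem mem_GG {m n : ℕ} (w : Fin m → A[X]) :
    w ∈ GG A m n ↔ ∀ i j, n ≤ j → (w i).coeff j = 0 := by
  simp [GG, Submodule.mem_pi, mem_degreeLT, degree_lt_iff_coeff_zero]

theorem fg_GG (m n : ℕ) : (GG A m n).FG :=
  Submodule.fg_pi fun _ => Module.Finite.iff_fg.1 inferInstance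

/-- vector of coefficients -/
noncomputable def cf (A : Type) [CommRing A] (m j : ℕ) : (Fin m → A[X]) →ₗ[A] (Fin m → A) :=
  LinearMap.pi fun i => lcoeff A j ∘ₗ LinearMap.proj i

@[simp] theorem cf_apply {m : ℕ} (j : ℕ) (w : Fin m → A[X]) (i : Fin m) :
    cf A m j w i = (w i).coeff j := rfl

/-- leading coefficients -/
noncomputable def LC {m : ℕ} (U : Submodule A[X] (Fin m → A[X])) (j : ℕ) : Submodule A (Fin m → A) :=
  (U.restrictScalars A ⊓ GG A m (j + 1)).map (cf A m j)

theorem LC_mono {m : ℕ} (U : Submodule A[X] (Fin m → A[X])) : Monotone (LC U) := by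
  refine monotone_nat_of_le_succ fun j => ?_
  rintro _ ⟨w, ⟨hw1, hw2⟩, rfl⟩
  have hw2' := (mem_GG w).1 hw2
  refine ⟨(X : A[X]) • w, ⟨U.smul_mem _ hw1, ?_⟩, ?_⟩
  · refine (mem_GG _).2 fun i l hl => ?_
    obtain ⟨l, rfl⟩ : ∃ l', l = l' + 1 := ⟨l - 1, by omega⟩
    simpa using hw2' i l (by omega)
  · ext i
    simp

theorem LC_stable [IsNoetherianRing A] {m : ℕ} (U : Submodule A[X] (Fin m → A[X])) :
    ∃ n, ∀ j, n ≤ j → LC U n = LC U j :=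
  monotone_stabilizes_iff_noetherian.2 (inferInstance : IsNoetherian A (Fin m → A))
    ⟨LC U, LC_mono U⟩

end

variable {A : Type} [CommRing A] {M : Type} [AddCommGroup M] [Module A M] [Module A[X] M]
  [IsScalarTower A A[X] M]

theorem theta_surjective (K : Submodule A M) (hK : Submodule.span A[X] (K : Set M) = ⊤) :
    Function.Surjective (theta K.subtype) := by
  rw [← LinearMap.range_eq_top, eq_top_iff, ← hK, Submodule.span_le]
  intro x hx
  refine ⟨single A 0 ⟨x, hx⟩, ?_⟩
  rw [theta_single]; simp

theorem Sfd_poly {d : ℕ} (N : Type) [AddCommGroup N] [Module A N] (h : Sfd A d N) :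
    Sfd A[X] d (PolynomialModule A N) :=
  h.baseChange.equiv (polynomialTensorProductLEquivPolynomialModule A N)

theorem swan_aux [IsNoetherianRing A] {d : ℕ}
    (hA : ∀ (N : Type) [AddCommGroup N] [Module A N] [Module.Finite A N], Sfd A d N)
    [Module.Finite A[X] M] : Sfd A[X] (d + 1) M := by
  obtain ⟨m, π, hπ⟩ := Module.Finite.exists_fin' A[X] M
  obtain ⟨n, hn⟩ := LC_stable (LinearMap.ker π)
  let πA : (Fin m → A[X]) →ₗ[A] M := π.restrictScalars A
  have hπA : ∀ w, πA w = π w := fun _ => rfl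
  let L := (GG A m n).map πA
  let K := (GG A m (n + 1)).map πA
  have hLK : L ≤ K := by
    refine Submodule.map_mono fun w hw => ?_
    rw [mem_GG] at hw ⊢
    exact fun i j hj => hw i j (by omega)
  have hX : ∀ x ∈ L, (X : A[X]) • x ∈ K := by
    rintro _ ⟨w, hw, rfl⟩
    refine ⟨(X : A[X]) • w, ?_, by simp [hπA]⟩
    have hw := (mem_GG w).1 hw
    refine (mem_GG _).2 fun i l hl => ?_
    obtain ⟨l, rfl⟩ : ∃ l', l = l' + 1 := ⟨l - 1, by omega⟩
    simpa using hw i l (by omega)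
  have hK : Submodule.span A[X] (K : Set M) = ⊤ := by
    rw [eq_top_iff]
    rintro x -
    obtain ⟨w, rfl⟩ := hπ x
    rw [pi_eq_sum_univ' w, map_sum]
    refine Submodule.sum_mem _ fun i _ => ?_
    rw [_root_.map_smul]
    refine Submodule.smul_mem _ _ (Submodule.subset_span ⟨_, ?_, rfl⟩)
    refine (mem_GG _).2 fun i' l hl => ?_
    by_cases hii : i' = i
    · subst hii; simp [coeff_one]; omega
    · simp [hii, Ne.symm hii]
  have hstar : ∀ (y : PolynomialModule A K) (B : ℕ), (∀ i, B + 2 ≤ i → y.coeff i = 0) →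
      theta K.subtype y = 0 → (y.coeff (B + 1) : M) ∈ L := by
    intro y B hB hy
    rw [theta_apply _ _ _ hB] at hy
    choose w hw1 hw2 using fun i => (y.coeff i).2
    have hw1' := fun i => (mem_GG _).1 (hw1 i)
    have hs : cf A m (n + (B + 1)) (∑ i ∈ Finset.range (B + 2), (X ^ i : A[X]) • w i) ∈
        LC (LinearMap.ker π) (n + (B + 1)) := by
      refine ⟨_, ⟨?_, ?_⟩, rfl⟩
      · change _ ∈ LinearMap.ker π
        rw [LinearMap.mem_ker, map_sum, ← hy]
        refine Finset.sum_congr rfl fun i _ => ?_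
        rw [_root_.map_smul, ← hπA, hw2]; rfl
      · refine Submodule.sum_mem _ fun i hi => (mem_GG _).2 fun i' l hl => ?_
        have hi := Finset.mem_range.1 hi
        rw [Pi.smul_apply, smul_eq_mul, coeff_X_pow_mul', if_pos (by omega)]
        exact hw1' _ _ _ (by omega)
    have hc : cf A m (n + (B + 1)) (∑ i ∈ Finset.range (B + 2), (X ^ i : A[X]) • w i) =
        cf A m n (w (B + 1)) := by
      rw [map_sum, Finset.sum_range_succ, Finset.sum_eq_zero, zero_add]
      · ext i
        simp [coeff_X_pow_mul]
      · intro i hi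
        have hi := Finset.mem_range.1 hi
        ext i'
        rw [cf_apply, Pi.smul_apply, smul_eq_mul, coeff_X_pow_mul', if_pos (by omega)]
        exact hw1' _ _ _ (by omega)
    rw [hc, ← hn _ (by omega)] at hs
    obtain ⟨u, ⟨hu1, hu2⟩, hu3⟩ := hs
    refine ⟨w (B + 1) - u, (mem_GG _).2 fun i l hl => ?_, ?_⟩
    · have hu2 := (mem_GG u).1 hu2
      rw [Pi.sub_apply, Polynomial.coeff_sub]
      rcases hl.eq_or_lt with rfl | hl
      · have := congrFun hu3 i
        simp only [cf_apply] at this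
        rw [this, sub_self]
      · rw [hu2 _ _ hl, hw1' _ _ _ hl, sub_self]
    · have hu1 : πA u = 0 := hu1
      rw [map_sub, hu1, sub_zero, hw2]
  haveI : Module.Finite A L := Module.Finite.iff_fg.2 ((fg_GG m n).map πA)
  haveI : Module.Finite A K := Module.Finite.iff_fg.2 ((fg_GG m (n + 1)).map πA)
  exact Sfd.quot (delta L K hLK hX) (theta K.subtype) (delta_injective L K hLK hX)
    (theta_surjective K hK) (SwanSeq.exact L K hLK hX hstar) (Sfd_poly L (hA L))
    (Sfd_poly K (hA K)).succ

theorem swan (A : Type) [CommRing A] [IsNoetherianRing A] (d : ℕ)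
    (hA : ∀ (N : Type) [AddCommGroup N] [Module A N] [Module.Finite A N], Sfd A d N)
    (M : Type) [AddCommGroup M] [Module A[X] M] [Module.Finite A[X] M] : Sfd A[X] (d + 1) M := by
  letI : Module A M := Module.compHom M (C : A →+* A[X])
  haveI : IsScalarTower A A[X] M := ⟨fun a p x => by
    rw [smul_eq_C_mul, mul_smul]; rfl⟩
  exact swan_aux hA

end SwanSeq

theorem finite_of_ringEquiv {R S M : Type} [CommRing R] [CommRing S] [AddCommGroup M]
    [Module R M] [Module S M] (e : R ≃+* S) (h : ∀ (r : R) (x : M), r • x = e r • x)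
    [Module.Finite S M] : Module.Finite R M := by
  let f : M →ₛₗ[(e.symm : S →+* R)] M :=
    { AddMonoidHom.id M with map_smul' := fun s x => by simp [h] }
  exact Module.Finite.of_surjective f Function.surjective_id

theorem sfd_mvPolynomial (k : Type) [Field k] (n : ℕ) : ∀ (M : Type) [AddCommGroup M]
    [Module (MvPolynomial (Fin n) k) M] [Module.Finite (MvPolynomial (Fin n) k) M],
    Sfd (MvPolynomial (Fin n) k) n M := by
  induction n with
  | zero =>
    intro M _ _ _
    let e : k ≃+* MvPolynomial (Fin 0) k := (MvPolynomial.isEmptyAlgEquiv k (Fin 0)).symm.toRingEquiv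
    letI : Module k M := Module.compHom M e.toRingHom
    haveI : Module.Finite k M := finite_of_ringEquiv e (fun _ _ => rfl)
    exact Sfd.transport e 0 M M (AddEquiv.refl M) (fun _ _ => rfl) Sfd.zero_of_free
  | succ n ih =>
    intro M _ _ _
    let e : Polynomial (MvPolynomial (Fin n) k) ≃+* MvPolynomial (Fin (n + 1)) k :=
      (MvPolynomial.finSuccEquiv k n).symm.toRingEquiv
    letI : Module (Polynomial (MvPolynomial (Fin n) k)) M := Module.compHom M e.toRingHom
    haveI : Module.Finite (Polynomial (MvPolynomial (Fin n) k)) M := finite_of_ringEquiv e (fun _ _ => rfl)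
    exact Sfd.transport e (n + 1) M M (AddEquiv.refl M) (fun _ _ => rfl)
      (SwanSeq.swan _ n ih M)

theorem sfd_of_isSyzygy {R : Type} [CommRing R] (j : ℕ) : ∀ (d : ℕ),
    (∀ (M : Type) [AddCommGroup M] [Module R M] [Module.Finite R M], Sfd R (j + d) M) →
    ∀ (M : Type) [AddCommGroup M] [Module R M] [Module.Finite R M], IsSyzygy R j M →
    Sfd R d M := by
  induction j with
  | zero => intro d h M _ _ _ _; simpa using h M
  | succ j ih =>
    rintro d h M _ _ _ ⟨m, f, hf, hs⟩
    have h1 := ih (d + 1) (fun M => by rw [show j + (d + 1) = j + 1 + d by ring]; exact h M) _ hs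
    have h2 := Sfd.ker (LinearMap.range f).mkQ (Submodule.mkQ_surjective _) h1
    rw [Submodule.ker_mkQ] at h2
    exact h2.equiv (LinearEquiv.ofInjective f hf).symm

/-- Let `R = k[x₁,…,xₙ]` be a polynomial ring in `n` variables over a field `k` and
`M` a finitely generated `R`-module. If `M` is an `n`-th syzygy, i.e. there is an
exact sequence `0 → M → F₁ → ⋯ → Fₙ` with each `F_k` finitely generated free, then
`M` is free. (This is the consequence of the Hilbert Syzygy Theorem.) -/
theorem free_of_nth_syzygy_over_polynomial_ring (k : Type) [Field k] (n : ℕ)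
    (M : Type) [AddCommGroup M] [Module (MvPolynomial (Fin n) k) M]
    [Module.Finite (MvPolynomial (Fin n) k) M]
    (h : IsSyzygy (MvPolynomial (Fin n) k) n M) :
    Module.Free (MvPolynomial (Fin n) k) M := by
  obtain ⟨P, _, _, h1, h2, h3, h4⟩ :=
    sfd_of_isSyzygy n 0 (fun M => sfd_mvPolynomial k n M) M h
  let bP := Module.finBasis (MvPolynomial (Fin n) k) P
  let bM := Module.finBasis (MvPolynomial (Fin n) k) (M × P)
  exact (hermite_mvPolynomial k n).free_of_prod_pow _ M _
    (((LinearEquiv.refl _ M).prodCongr bP.equivFun.symm).trans bM.equivFun)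
end

section
/- The space F = {(x,y) ∈ S¹ × D² : |x−y| ≤ 1} is homeomorphic to the solid torus S¹ × D², where D² is the closed unit disk in ℝ². -/
open Metric in
theorem lens_homeo : ∃ h : ℂ ≃ₜ ℂ, ∀ y : ℂ, ‖h y‖ ≤ 1 ↔ (‖y‖ ≤ 1 ∧ ‖1 - y‖ ≤ 1) := by
  have hcl : IsClosed (closedBall (0 : ℂ) 1 ∩ closedBall 1 1) :=
    isClosed_closedBall.inter isClosed_closedBall
  obtain ⟨h, -, h2, -⟩ := exists_homeomorph_image_interior_closure_frontier_eq_unitBall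
    (s := closedBall (0 : ℂ) 1 ∩ closedBall 1 1)
    ((convex_closedBall _ _).inter (convex_closedBall _ _))
    (by
      refine ⟨1 / 2, ?_⟩
      rw [interior_inter]
      refine ⟨ball_subset_interior_closedBall ?_, ball_subset_interior_closedBall ?_⟩
      · rw [mem_ball, dist_eq_norm]; norm_num
      · rw [mem_ball, dist_eq_norm]; norm_num)
    (isBounded_closedBall.subset Set.inter_subset_left)
  rw [hcl.closure_eq] at h2
  refine ⟨h, fun y => ?_⟩
  have h3 : h y ∈ closedBall (0 : ℂ) 1 ↔ y ∈ closedBall (0 : ℂ) 1 ∩ closedBall 1 1 := by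
    have h4 := h.injective.mem_set_image (s := closedBall (0 : ℂ) 1 ∩ closedBall 1 1) (a := y)
    rwa [h2] at h4
  rw [Set.mem_inter_iff, mem_closedBall_zero_iff, mem_closedBall_zero_iff, mem_closedBall,
    dist_comm, dist_eq_norm] at h3
  exact h3

theorem unit_mul_conj {x : ℂ} (hx : ‖x‖ = 1) : x * (starRingEnd ℂ) x = 1 := by
  rw [Complex.mul_conj']; simp [hx]

theorem unit_conj_mul {x : ℂ} (hx : ‖x‖ = 1) : (starRingEnd ℂ) x * x = 1 := by
  rw [mul_comm, unit_mul_conj hx]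

/-- The space `F = {(x,y) ∈ S¹ × D² : |x−y| ≤ 1}` (with `S¹ ⊂ ℂ` the unit circle
and `D² ⊂ ℂ` the closed unit disk) is homeomorphic to the solid torus `S¹ × D²`. -/
theorem config_space_homeo_solid_torus :
    Nonempty
      ({p : ℂ × ℂ // ‖p.1‖ = 1 ∧ ‖p.2‖ ≤ 1 ∧ ‖p.1 - p.2‖ ≤ 1} ≃ₜ
        (Metric.sphere (0 : ℂ) 1 × Metric.closedBall (0 : ℂ) 1)) := by
  obtain ⟨h, hh⟩ := lens_homeo
  refine ⟨{
    toFun := fun p => (⟨p.1.1, by simpa using p.2.1⟩,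
      ⟨h ((starRingEnd ℂ) p.1.1 * p.1.2), ?_⟩)
    invFun := fun q => ⟨(q.1.1, q.1.1 * h.symm q.2.1), ?_⟩
    left_inv := ?_
    right_inv := ?_
    continuous_toFun := ?_
    continuous_invFun := ?_ }⟩
  · obtain ⟨⟨x, y⟩, hx, hy, hxy⟩ := p
    dsimp only at hx hy hxy ⊢
    rw [mem_closedBall_zero_iff, hh]
    refine ⟨by simpa [hx] using hy, ?_⟩
    rw [← unit_conj_mul hx, ← mul_sub, norm_mul]
    simpa [hx] using hxy
  · obtain ⟨⟨x, hx⟩, ⟨z, hz⟩⟩ := q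
    rw [mem_sphere_zero_iff_norm] at hx
    rw [mem_closedBall_zero_iff, ← h.apply_symm_apply z, hh] at hz
    dsimp only
    refine ⟨hx, by simpa [hx] using hz.1, ?_⟩
    have : x - x * h.symm z = x * (1 - h.symm z) := by ring
    rw [this, norm_mul, hx, one_mul]
    exact hz.2
  · rintro ⟨⟨x, y⟩, hx, hy, hxy⟩
    dsimp only at hx
    simp [← mul_assoc, unit_mul_conj hx]
  · rintro ⟨⟨x, hx⟩, ⟨z, hz⟩⟩
    rw [mem_sphere_zero_iff_norm] at hx
    simp [← mul_assoc, unit_conj_mul hx]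
  · have h1 := h.continuous
    have h2 := Complex.continuous_conj
    fun_prop
  · have h1 := h.symm.continuous
    fun_prop
end
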